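/- arXiv:2409.10745 — 2 statements merged into one kernel-verified Lean document; each statement's English description precedes it below -/
import Mathlib

section
/- Let (X,G,α) be a topological dynamical system. Then the maximal pattern entropy of the action equals the supremum of the topological sequence entropies over all sequences in G: h*_{top}(X,G) = sup_{𝔰∈S(G)} h^𝔰_{top}(X,G). -/
open Filter Topology Set
open scoped ENNReal Classical

section EntropyDefs

variable {G X : Type*}

/-- `𝒰` is an open cover of `X`. -/
def IsOpenCover [TopologicalSpace X] (𝒰 : Set (Set X)) : Prop :=
  (∀ U ∈ 𝒰, IsOpen U) ∧ ⋃₀ 𝒰 = Set.univ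

/-- `N(𝒰)`: the minimal cardinality of a finite subcover of `𝒰`
(junk value `0` if no finite subcover exists). -/
noncomputable def coverN (𝒰 : Set (Set X)) : ℕ :=
  sInf {n : ℕ | ∃ F : Finset (Set X), ↑F ⊆ 𝒰 ∧ F.card = n ∧ ⋃₀ (F : Set (Set X)) = Set.univ}

/-- The join `⋁_{i=1}^n α_{g_i⁻¹}(𝒰)` of the covers `α_{g_i⁻¹}(𝒰) = (α g_i)⁻¹'(𝒰)`. -/
def joinPull (α : G → X → X) (𝒰 : Set (Set X)) {n : ℕ} (g : Fin n → G) : Set (Set X) :=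
  {V | ∃ U : Fin n → Set X, (∀ i, U i ∈ 𝒰) ∧ V = ⋂ i, α (g i) ⁻¹' U i}

/-- Topological sequence entropy of the cover `𝒰` along the sequence `𝔰`:
`h_top^𝔰(𝒰,G) = limsup_n (1/n) log N(⋁_{i=1}^n α_{𝔰(i)⁻¹}(𝒰))`, valued in `[0,∞]`. -/
noncomputable def seqEntCover (α : G → X → X) (𝔰 : ℕ → G) (𝒰 : Set (Set X)) : ℝ≥0∞ :=
  Filter.atTop.limsup fun n : ℕ =>
    ENNReal.ofReal (Real.log (coverN (joinPull α 𝒰 fun i : Fin n => 𝔰 i)) / n)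

/-- Topological sequence entropy of the action along `𝔰`: supremum over all open covers. -/
noncomputable def seqEnt [TopologicalSpace X] (α : G → X → X) (𝔰 : ℕ → G) : ℝ≥0∞ :=
  ⨆ 𝒰 ∈ {𝒰 : Set (Set X) | IsOpenCover 𝒰}, seqEntCover α 𝔰 𝒰

/-- `p*_{X,G,𝒰}(n) = max_{(g_1,…,g_n) ∈ Gⁿ} N(⋁_{i=1}^n α_{g_i⁻¹}(𝒰))`. -/
noncomputable def patN (α : G → X → X) (𝒰 : Set (Set X)) (n : ℕ) : ℕ :=
  sSup {m : ℕ | ∃ g : Fin n → G, m = coverN (joinPull α 𝒰 g)}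

/-- Maximal pattern entropy of the cover `𝒰`: `lim_n (1/n) log p*_{X,G,𝒰}(n)`
(the limit exists by subadditivity and coincides with the limsup used here). -/
noncomputable def patEntCover (α : G → X → X) (𝒰 : Set (Set X)) : ℝ≥0∞ :=
  Filter.atTop.limsup fun n : ℕ => ENNReal.ofReal (Real.log (patN α 𝒰 n) / n)

/-- Maximal pattern entropy `h*_top(X,G)`: supremum over all open covers. -/
noncomputable def patEnt [TopologicalSpace X] (α : G → X → X) : ℝ≥0∞ :=
  ⨆ 𝒰 ∈ {𝒰 : Set (Set X) | IsOpenCover 𝒰}, patEntCover α 𝒰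

/-- `α` is an action of `G` on `X` by homeomorphisms. -/
def IsActionBy [Group G] [TopologicalSpace X] (α : G → X → X) : Prop :=
  (∀ x, α 1 x = x) ∧ (∀ g h x, α (g * h) x = α g (α h x)) ∧ ∀ g, Continuous (α g)

/-- `I ⊆ G` is an independence set for the tuple `(A 1, …, A k)`:
for every nonempty finite `F ⊆ I` and every `ω : F → {1,…,k}` we have
`⋂_{g ∈ F} α_{g⁻¹}(A (ω g)) ≠ ∅`. -/
def IsIndepSet (α : G → X → X) {k : ℕ} (A : Fin k → Set X) (I : Set G) : Prop :=
  ∀ F : Finset G, ↑F ⊆ I → F.Nonempty → ∀ ω : G → Fin k,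
    (⋂ g ∈ F, α g ⁻¹' A (ω g)).Nonempty

/-- The tuple `(A 1, …, A k)` has arbitrarily large finite independence sets. -/
def HasArbLargeIndep (α : G → X → X) {k : ℕ} (A : Fin k → Set X) : Prop :=
  ∀ n : ℕ, ∃ F : Finset G, n ≤ F.card ∧ IsIndepSet α A ↑F

/-- `(x 1, …, x k)` is an IN-tuple: every product neighbourhood has arbitrarily large
finite independence sets. -/
def IsINTuple [TopologicalSpace X] (α : G → X → X) {k : ℕ} (x : Fin k → X) : Prop :=
  ∀ U : Fin k → Set X, (∀ i, IsOpen (U i)) → (∀ i, x i ∈ U i) → HasArbLargeIndep α U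

/-- The action `α` of `G` on `X` is (topologically) weak-mixing. -/
def IsWeakMixing [TopologicalSpace X] (α : G → X → X) : Prop :=
  ∀ U₁ U₂ V₁ V₂ : Set X, IsOpen U₁ → IsOpen U₂ → IsOpen V₁ → IsOpen V₂ →
    U₁.Nonempty → U₂.Nonempty → V₁.Nonempty → V₂.Nonempty →
    ∃ g : G, (U₁ ∩ α g '' V₁).Nonempty ∧ (U₂ ∩ α g '' V₂).Nonempty

/-- `(x₁,x₂)` is a sequence entropy pair. -/
def IsSeqEntropyPair [TopologicalSpace X] (α : G → X → X) (x₁ x₂ : X) : Prop :=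
  x₁ ≠ x₂ ∧ ∀ A₁ A₂ : Set X, IsClosed A₁ → IsClosed A₂ →
    A₁ ∈ nhds x₁ → A₂ ∈ nhds x₂ → Disjoint A₁ A₂ →
    ∃ 𝔰 : ℕ → G, 0 < seqEntCover α 𝔰 {A₁ᶜ, A₂ᶜ}

/-- `(x 1, …, x k)` is a sequence entropy tuple: it is not diagonal, and whenever
`U i` are closed neighbourhoods of the `x i` which coincide on equal coordinates and are
pairwise disjoint on distinct coordinates (i.e. pairwise disjoint closed neighbourhoods of
the distinct points of the tuple), some sequence gives positive sequence entropy for the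
cover by their complements. -/
def IsSeqEntropyTuple [TopologicalSpace X] (α : G → X → X) {k : ℕ} (x : Fin k → X) : Prop :=
  (∃ i j, x i ≠ x j) ∧ ∀ U : Fin k → Set X,
    (∀ i, IsClosed (U i)) → (∀ i, U i ∈ nhds (x i)) →
    (∀ i j, x i = x j → U i = U j) → (∀ i j, x i ≠ x j → Disjoint (U i) (U j)) →
    ∃ 𝔰 : ℕ → G, 0 < seqEntCover α 𝔰 (Set.range fun i => (U i)ᶜ)

end EntropyDefs

namespace CoInd

variable {G : Type*} [Group G] (H : Subgroup G)

/-- `H\G`, the space of right cosets of `H` in `G`. -/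
abbrev RQ := Quotient (QuotientGroup.rightRel H)

/-- Right multiplication `Hg ↦ H(g·g₀)` on the right coset space. -/
def rmul (g₀ : G) : RQ H → RQ H :=
  Quotient.map' (fun g => g * g₀) (fun a b hab => by
    rw [QuotientGroup.rightRel_apply] at hab ⊢
    have h2 : b * g₀ * (a * g₀)⁻¹ = b * a⁻¹ := by group
    rw [h2]; exact hab)

/-- `s : H\G → G` is a section of the right cosets with `s(H) = e`. -/
def IsSection (s : RQ H → G) : Prop :=
  (∀ θ : RQ H, Quotient.mk'' (s θ) = θ) ∧ s (Quotient.mk'' 1) = 1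

variable {X : Type*}

/-- The co-induced action `α^{H\G}` of `G` on `X_H^G = ∏_{θ ∈ H\G} X`, relative to a
section `s` of the right cosets:
`(α^{H\G}_{g₀} f)(Hg) = α_{s(Hg)·g₀·s(Hg·g₀)⁻¹} (f (Hg·g₀))`.
(When `s` is a genuine section the element `s(Hg)·g₀·s(Hg·g₀)⁻¹` always lies in `H`,
so the `else` branch is never taken.) -/
noncomputable def coindAct (α : ↥H → X → X) (s : RQ H → G) (g₀ : G)
    (f : RQ H → X) : RQ H → X := fun θ =>
  if h : s θ * g₀ * (s (rmul H g₀ θ))⁻¹ ∈ H then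
    α ⟨s θ * g₀ * (s (rmul H g₀ θ))⁻¹, h⟩ (f (rmul H g₀ θ))
  else f (rmul H g₀ θ)

end CoInd

section PatternEntropy

variable {G X : Type*}

lemma coverN_le_card {𝒰 : Set (Set X)} {F : Finset (Set X)} (hF : ↑F ⊆ 𝒰)
    (hcov : ⋃₀ (F : Set (Set X)) = Set.univ) : coverN 𝒰 ≤ F.card :=
  Nat.sInf_le ⟨F, hF, rfl, hcov⟩

lemma exists_card_eq_coverN {𝒰 : Set (Set X)}
    (h : ∃ F : Finset (Set X), ↑F ⊆ 𝒰 ∧ ⋃₀ (F : Set (Set X)) = Set.univ) :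
    ∃ F : Finset (Set X), ↑F ⊆ 𝒰 ∧ F.card = coverN 𝒰 ∧ ⋃₀ (F : Set (Set X)) = Set.univ := by
  obtain ⟨F, hF, hcov⟩ := h
  exact Nat.sInf_mem (s := {n : ℕ | ∃ F : Finset (Set X), ↑F ⊆ 𝒰 ∧ F.card = n ∧
    ⋃₀ (F : Set (Set X)) = Set.univ}) ⟨_, F, hF, rfl, hcov⟩

lemma coverN_le_of_refines {𝒱 𝒲 : Set (Set X)}
    (h : ∃ F : Finset (Set X), ↑F ⊆ 𝒱 ∧ ⋃₀ (F : Set (Set X)) = Set.univ)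
    (href : ∀ V ∈ 𝒱, ∃ W ∈ 𝒲, V ⊆ W) : coverN 𝒲 ≤ coverN 𝒱 := by
  obtain ⟨F, hF, hcard, hcov⟩ := exists_card_eq_coverN h
  choose! f hf hsub using href
  rw [← hcard]
  refine (coverN_le_card (F := F.image f) ?_ ?_).trans Finset.card_image_le
  · intro W hW
    obtain ⟨V, hV, rfl⟩ := Finset.mem_image.1 (Finset.mem_coe.1 hW)
    exact hf V (hF hV)
  · refine Set.eq_univ_of_forall fun x => ?_
    obtain ⟨V, hV, hx⟩ : x ∈ ⋃₀ (F : Set (Set X)) := hcov ▸ Set.mem_univ x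
    exact ⟨f V, Finset.mem_coe.2 (Finset.mem_image_of_mem f hV), hsub V (hF hV) hx⟩

lemma IsOpenCover.exists_finset [TopologicalSpace X] [CompactSpace X] {𝒰 : Set (Set X)}
    (h𝒰 : IsOpenCover 𝒰) :
    ∃ F : Finset (Set X), ↑F ⊆ 𝒰 ∧ ⋃₀ (F : Set (Set X)) = Set.univ := by
  obtain ⟨T, hT, hfin, hcov⟩ := isCompact_univ.elim_finite_subcover_image (b := 𝒰) (c := id)
    h𝒰.1 (by rw [← h𝒰.2, Set.sUnion_eq_biUnion]; rfl)
  refine ⟨hfin.toFinset, by simpa using hT, Set.eq_univ_of_univ_subset ?_⟩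
  rw [Set.sUnion_eq_biUnion]
  simpa using hcov

/-- The join of pulled back covers has a subcover of cardinality at most that of a power of a
subcover of `𝒰`. -/
lemma exists_finset_joinPull (α : G → X → X) {𝒰 : Set (Set X)} {F : Finset (Set X)}
    (hF : ↑F ⊆ 𝒰) (hcov : ⋃₀ (F : Set (Set X)) = Set.univ) {n : ℕ} (g : Fin n → G) :
    ∃ E : Finset (Set X), ↑E ⊆ joinPull α 𝒰 g ∧ ⋃₀ (E : Set (Set X)) = Set.univ ∧
      E.card ≤ F.card ^ n := by
  refine ⟨(Fintype.piFinset fun _ : Fin n => F).image fun U => ⋂ i, α (g i) ⁻¹' U i,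
    ?_, ?_, ?_⟩
  · intro V hV
    obtain ⟨U, hU, rfl⟩ := Finset.mem_image.1 (Finset.mem_coe.1 hV)
    exact ⟨U, fun i => hF (Fintype.mem_piFinset.1 hU i), rfl⟩
  · refine Set.eq_univ_of_forall fun x => ?_
    have hx : ∀ i, ∃ U ∈ F, α (g i) x ∈ U := fun i => by
      have : α (g i) x ∈ ⋃₀ (F : Set (Set X)) := hcov ▸ Set.mem_univ _
      simpa using this
    choose U hU hxU using hx
    exact ⟨_, Finset.mem_coe.2 (Finset.mem_image_of_mem _ (Fintype.mem_piFinset.2 hU)),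
      Set.mem_iInter.2 hxU⟩
  · exact Finset.card_image_le.trans (by simp)

variable [TopologicalSpace X] [CompactSpace X] {𝒰 : Set (Set X)}

lemma bddAbove_coverN_joinPull (α : G → X → X) (h𝒰 : IsOpenCover 𝒰) (n : ℕ) :
    BddAbove {m : ℕ | ∃ g : Fin n → G, m = coverN (joinPull α 𝒰 g)} := by
  obtain ⟨F, hF, hcov⟩ := h𝒰.exists_finset
  refine ⟨F.card ^ n, ?_⟩
  rintro m ⟨g, rfl⟩
  obtain ⟨E, hE, hEcov, hcard⟩ := exists_finset_joinPull α hF hcov g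
  exact (coverN_le_card hE hEcov).trans hcard

lemma coverN_joinPull_le_patN (α : G → X → X) (h𝒰 : IsOpenCover 𝒰) {n : ℕ} (g : Fin n → G) :
    coverN (joinPull α 𝒰 g) ≤ patN α 𝒰 n :=
  le_csSup (bddAbove_coverN_joinPull α h𝒰 n) ⟨g, rfl⟩

lemma exists_coverN_joinPull_eq_patN [Nonempty G] (α : G → X → X) (h𝒰 : IsOpenCover 𝒰) (n : ℕ) :
    ∃ g : Fin n → G, patN α 𝒰 n = coverN (joinPull α 𝒰 g) :=
  Nat.sSup_mem (s := {m : ℕ | ∃ g : Fin n → G, m = coverN (joinPull α 𝒰 g)})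
    ⟨_, fun _ => Classical.arbitrary G, rfl⟩ (bddAbove_coverN_joinPull α h𝒰 n)

lemma coverN_joinPull_comp_le (α : G → X → X) (h𝒰 : IsOpenCover 𝒰) {m n : ℕ} (g : Fin m → G)
    (e : Fin n → Fin m) : coverN (joinPull α 𝒰 (g ∘ e)) ≤ coverN (joinPull α 𝒰 g) := by
  obtain ⟨F, hF, hcov⟩ := h𝒰.exists_finset
  obtain ⟨E, hE, hEcov, -⟩ := exists_finset_joinPull α hF hcov g
  refine coverN_le_of_refines ⟨E, hE, hEcov⟩ ?_
  rintro V ⟨U, hU, rfl⟩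
  exact ⟨_, ⟨U ∘ e, fun i => hU (e i), rfl⟩,
    Set.subset_iInter fun i => Set.iInter_subset _ (e i)⟩

lemma log_natCast_le_log_natCast {m n : ℕ} (h : m ≤ n) : Real.log m ≤ Real.log n := by
  rcases Nat.eq_zero_or_pos m with rfl | hm
  · simpa using Real.log_natCast_nonneg n
  · exact Real.log_le_log (by exact_mod_cast hm) (by exact_mod_cast h)

lemma seqEntCover_le_patEntCover (α : G → X → X) (𝔰 : ℕ → G) (h𝒰 : IsOpenCover 𝒰) :
    seqEntCover α 𝔰 𝒰 ≤ patEntCover α 𝒰 := by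
  refine limsup_le_limsup (Eventually.of_forall fun n => ENNReal.ofReal_le_ofReal ?_)
  exact div_le_div_of_nonneg_right
    (log_natCast_le_log_natCast (coverN_joinPull_le_patN α h𝒰 _)) n.cast_nonneg

/-- A sequence realizing prescribed values on the consecutive blocks `[M k, M (k + 1))`. -/
lemma exists_seq_eq_on_blocks {M : ℕ → ℕ} (hM : StrictMono M) (w : ℕ → ℕ → G) :
    ∃ 𝔰 : ℕ → G, ∀ k i, M k ≤ i → i < M (k + 1) → 𝔰 i = w k i := by
  have hex : ∀ i, ∃ k, i < M (k + 1) := fun i => ⟨i, hM.le_apply (x := i + 1)⟩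
  refine ⟨fun i => w (Nat.find (hex i)) i, fun k i hki hik => ?_⟩
  have : Nat.find (hex i) = k := by
    refine (Nat.find_eq_iff _).2 ⟨hik, fun j hj => not_lt.2 ?_⟩
    exact (hM.monotone hj).trans hki
  simp only [this]

/-- Concatenating blocks of rapidly increasing length that nearly realize the maximal pattern
entropy yields a sequence whose entropy is nearly the maximal pattern entropy. -/
lemma exists_seq_le_seqEntCover [Nonempty G] (α : G → X → X) (h𝒰 : IsOpenCover 𝒰)
    {a : ℝ≥0∞} (ha : a < patEntCover α 𝒰) : ∃ 𝔰 : ℕ → G, a ≤ seqEntCover α 𝔰 𝒰 := by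
  obtain ⟨c, hac, hc⟩ := exists_between ha
  lift c to NNReal using hc.ne_top
  lift a to NNReal using hac.ne_top
  replace hac : (a : ℝ) < c := by exact_mod_cast hac
  have hfreq := frequently_lt_of_lt_limsup (h := hc)
  have hblock : ∀ m : ℕ, ∃ n : ℕ, 0 < n ∧
      ∃ g : Fin n → G, (a : ℝ) * (m + n) ≤ Real.log (coverN (joinPull α 𝒰 g)) := by
    intro m
    obtain ⟨N, hN⟩ := exists_nat_ge ((a : ℝ) * m / (c - a))
    obtain ⟨n, hn, hlt⟩ := frequently_atTop.1 hfreq (max N 1)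
    have hn0 : 0 < n := (le_max_right N 1).trans hn
    have hnN : (N : ℝ) ≤ n := by exact_mod_cast (le_max_left N 1).trans hn
    obtain ⟨g, hg⟩ := exists_coverN_joinPull_eq_patN α h𝒰 n
    refine ⟨n, hn0, g, ?_⟩
    rw [← ENNReal.ofReal_coe_nnreal, ENNReal.ofReal_lt_ofReal_iff_of_nonneg c.coe_nonneg,
      lt_div_iff₀ (by exact_mod_cast hn0), hg] at hlt
    have := (div_le_iff₀ (sub_pos.2 hac)).1 (hN.trans hnN)
    linarith
  choose len hlen g hg using hblock
  let M : ℕ → ℕ := fun k => Nat.rec 0 (fun _ m => m + len m) k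
  have hMsucc : ∀ k, M (k + 1) = M k + len (M k) := fun _ => rfl
  have hM : StrictMono M := strictMono_nat_of_lt_succ fun k => by
    have := hlen (M k)
    have := hMsucc k
    omega
  obtain ⟨𝔰, h𝔰⟩ := exists_seq_eq_on_blocks hM fun k i =>
    if h : i - M k < len (M k) then g (M k) ⟨i - M k, h⟩ else Classical.arbitrary G
  refine ⟨𝔰, le_limsup_of_frequently_le (frequently_atTop.2 fun k => ?_)⟩
  refine ⟨M (k + 1), (Nat.le_succ k).trans hM.le_apply, ?_⟩
  have hpos : (0 : ℝ) < M (k + 1) := by exact_mod_cast (Nat.zero_le _).trans_lt (hM k.lt_succ_self)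
  rw [← ENNReal.ofReal_coe_nnreal]
  refine ENNReal.ofReal_le_ofReal ((le_div_iff₀ hpos).2 ?_)
  have hcomp : g (M k) = (fun i : Fin (M (k + 1)) => 𝔰 i) ∘
      fun j : Fin (len (M k)) => ⟨M k + j, by have := j.2; have := hMsucc k; omega⟩ := by
    funext j
    have hj := j.2
    have := h𝔰 k (M k + j) (Nat.le_add_right _ _) (by rw [hMsucc]; omega)
    simp [this]
  rw [hMsucc, Nat.cast_add]
  refine (hg (M k)).trans (log_natCast_le_log_natCast ?_)
  rw [hcomp]
  exact coverN_joinPull_comp_le α h𝒰 _ _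

lemma patEntCover_eq_iSup_seqEntCover [Nonempty G] (α : G → X → X) (h𝒰 : IsOpenCover 𝒰) :
    patEntCover α 𝒰 = ⨆ 𝔰 : ℕ → G, seqEntCover α 𝔰 𝒰 := by
  refine le_antisymm (le_of_forall_lt_imp_le_of_dense fun a ha => ?_)
    (iSup_le fun 𝔰 => seqEntCover_le_patEntCover α 𝔰 h𝒰)
  obtain ⟨𝔰, h𝔰⟩ := exists_seq_le_seqEntCover α h𝒰 ha
  exact h𝔰.trans (le_iSup (fun 𝔰 => seqEntCover α 𝔰 𝒰) 𝔰)

end PatternEntropy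

/-- Huang–Ye: `h*_top(X,G) = sup_{𝔰 ∈ S(G)} h^𝔰_top(X,G)`. -/
theorem maximal_pattern_entropy_eq_sup_seq_entropy
    {G X : Type*} [Group G] [Countable G] [Infinite G] [MetricSpace X] [CompactSpace X]
    (α : G → X → X) (hα : IsActionBy α) :
    patEnt α = ⨆ 𝔰 : ℕ → G, seqEnt α 𝔰 := by
  unfold patEnt seqEnt
  rw [iSup_comm]
  refine iSup_congr fun 𝒰 => ?_
  rw [iSup_comm]
  exact iSup_congr fun h𝒰 => patEntCover_eq_iSup_seqEntCover α h𝒰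
end

section
/- Let (X,G,α) be a topological dynamical system. Then IN_2(X,G) \ Δ_2(X) is nonempty if and only if (X,G,α) is nonnull, i.e. there exists a sequence 𝔰 in G with h^𝔰_{top}(X,G) > 0. -/
open Filter Topology Set
open scoped ENNReal Classical

section PartialShattering

variable {ι Y : Type*}

/-- The index set `J` is shattered by the points of `H`, for the partial `{0,1}`-labelling of
`Y × ι` in which `y` has label `c` at `i` when `y ∈ S i c`. -/
def PartialShatters (S : ι → Fin 2 → Set Y) (H : Set Y) (J : Finset ι) : Prop :=
  ∀ ω : ι → Fin 2, ∃ y ∈ H, ∀ j ∈ J, y ∈ S j (ω j)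

/-- The number of subsets of `K` which are shattered by `H`. -/
noncomputable def shatterCount (S : ι → Fin 2 → Set Y) (K : Finset ι) (H : Set Y) : ℕ :=
  (K.powerset.filter fun J => PartialShatters S H J).card

theorem PartialShatters.mono {S : ι → Fin 2 → Set Y} {H H' : Set Y} {J : Finset ι}
    (h : PartialShatters S H J) (hH : H ⊆ H') : PartialShatters S H' J := fun ω =>
  let ⟨y, hy, hyJ⟩ := h ω
  ⟨y, hH hy, hyJ⟩

theorem shatterCount_pos (S : ι → Fin 2 → Set Y) (K : Finset ι) {H : Set Y} (hH : H.Nonempty) :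
    0 < shatterCount S K H := by
  obtain ⟨y, hy⟩ := hH
  refine Finset.card_pos.2 ⟨∅, Finset.mem_filter.2 ⟨Finset.empty_mem_powerset K, fun ω => ?_⟩⟩
  exact ⟨y, hy, by simp⟩

theorem shatterCount_mono (S : ι → Fin 2 → Set Y) {K K' : Finset ι} {H H' : Set Y}
    (hK : K ⊆ K') (hH : H ⊆ H') : shatterCount S K H ≤ shatterCount S K' H' := by
  refine Finset.card_le_card fun J hJ => ?_
  rw [Finset.mem_filter, Finset.mem_powerset] at hJ ⊢
  exact ⟨hJ.1.trans hK, hJ.2.mono hH⟩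

theorem shatterCount_add_le (S : ι → Fin 2 → Set Y) {K : Finset ι} {i : ι} (hi : i ∉ K)
    (H : Set Y) :
    shatterCount S K (H ∩ S i 0) + shatterCount S K (H ∩ S i 1) ≤
      shatterCount S (insert i K) H := by
  set P := K.powerset.filter fun J => PartialShatters S (H ∩ S i 0) J with hP
  set Q := K.powerset.filter fun J => PartialShatters S (H ∩ S i 1) J with hQ
  have hPQ : ((P ∩ Q).image (insert i)).card = (P ∩ Q).card := by
    refine Finset.card_image_of_injOn fun J hJ J' hJ' h => ?_
    have hJK : J ⊆ K := by simp [hP] at hJ; exact hJ.1.1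
    have hJK' : J' ⊆ K := by simp [hP] at hJ'; exact hJ'.1.1
    rw [← Finset.erase_insert (fun h => hi (hJK h)), ← Finset.erase_insert (fun h => hi (hJK' h))]
    exact congrArg (fun T => Finset.erase T i) h
  have hdisj : Disjoint (P ∪ Q) ((P ∩ Q).image (insert i)) := by
    rw [Finset.disjoint_left]
    intro J hJ hJ'
    have hJK : J ⊆ K := by
      rcases Finset.mem_union.1 hJ with h | h <;>
        exact Finset.mem_powerset.1 (Finset.mem_filter.1 h).1
    obtain ⟨J', -, rfl⟩ := Finset.mem_image.1 hJ'
    exact hi (hJK (Finset.mem_insert_self i J'))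
  calc P.card + Q.card = (P ∪ Q).card + ((P ∩ Q).image (insert i)).card := by
        rw [hPQ, Finset.card_union_add_card_inter]
    _ = ((P ∪ Q) ∪ (P ∩ Q).image (insert i)).card := (Finset.card_union_of_disjoint hdisj).symm
    _ ≤ shatterCount S (insert i K) H := by
        refine Finset.card_le_card fun J hJ => ?_
        rw [Finset.mem_filter, Finset.mem_powerset]
        rcases Finset.mem_union.1 hJ with h | h
        · rcases Finset.mem_union.1 h with h | h <;> rw [Finset.mem_filter, Finset.mem_powerset] at h
          · exact ⟨h.1.trans (Finset.subset_insert i K), h.2.mono inter_subset_left⟩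
          · exact ⟨h.1.trans (Finset.subset_insert i K), h.2.mono inter_subset_left⟩
        · clear hJ
          obtain ⟨J, hJ, rfl⟩ := Finset.mem_image.1 h
          rw [Finset.mem_inter, Finset.mem_filter, Finset.mem_filter, Finset.mem_powerset] at hJ
          refine ⟨Finset.insert_subset_insert i hJ.1.1, fun ω => ?_⟩
          have key : ∃ y ∈ H ∩ S i (ω i), ∀ j ∈ J, y ∈ S j (ω j) := by
            generalize hc : ω i = c
            fin_cases c
            · exact hJ.1.2 ω
            · exact hJ.2.2 ω
          obtain ⟨y, hy, hyJ⟩ := key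
          refine ⟨y, hy.1, fun j hj => ?_⟩
          rcases Finset.mem_insert.1 hj with rfl | hj
          · exact hy.2
          · exact hyJ j hj

/-- A partial class with fewer than `2 ^ L` shattered sets is covered by at most
`(|K| + 1) ^ L` total words, each point avoiding the labels of some word. -/
theorem exists_words_of_shatterCount_lt {S : ι → Fin 2 → Set Y}
    (hS : ∀ i, Disjoint (S i 0) (S i 1)) (K : Finset ι) :
    ∀ (L : ℕ) (H : Set Y), shatterCount S K H < 2 ^ L →
      ∃ W : Finset (ι → Fin 2), W.card ≤ (K.card + 1) ^ L ∧
        ∀ y ∈ H, ∃ w ∈ W, ∀ i ∈ K, y ∉ S i (w i) := by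
  induction K using Finset.induction_on with
  | empty => exact fun L H _ => ⟨{fun _ => 0}, by simp, fun y _ => ⟨fun _ => 0, by simp⟩⟩
  | insert i K hi ih =>
    intro L H hL
    rcases H.eq_empty_or_nonempty with rfl | hH
    · exact ⟨∅, by simp, by simp⟩
    obtain _ | L := L
    · have := shatterCount_pos S (insert i K) hH
      omega
    have hadd := shatterCount_add_le S hi H
    obtain ⟨m, hm⟩ : ∃ m : Fin 2, shatterCount S K (H ∩ S i m) < 2 ^ L := by
      by_contra! h
      have h0 := h 0
      have h1 := h 1
      rw [pow_succ] at hL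
      omega
    have hSm : ∀ y ∈ S i m, y ∉ S i (m + 1) := by
      intro y
      fin_cases m
      · exact fun h => Set.disjoint_left.1 (hS i) h
      · exact fun h => Set.disjoint_right.1 (hS i) h
    obtain ⟨W₁, hW₁, hc₁⟩ := ih L _ hm
    obtain ⟨W₂, hW₂, hc₂⟩ := ih (L + 1) (H \ S i m)
      ((shatterCount_mono S (Finset.subset_insert i K) sdiff_subset).trans_lt hL)
    refine ⟨W₁.image (fun w => Function.update w i (m + 1)) ∪
      W₂.image (fun w => Function.update w i m), ?_, fun y hy => ?_⟩
    · calc _ ≤ W₁.card + W₂.card :=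
            (Finset.card_union_le _ _).trans
              (add_le_add Finset.card_image_le Finset.card_image_le)
        _ ≤ (K.card + 1) ^ L + (K.card + 1) ^ (L + 1) := add_le_add hW₁ hW₂
        _ = (K.card + 1) ^ L * (K.card + 1 + 1) := by ring
        _ ≤ (K.card + 1 + 1) ^ L * (K.card + 1 + 1) := by gcongr; omega
        _ = ((insert i K).card + 1) ^ (L + 1) := by
            rw [Finset.card_insert_of_notMem hi, pow_succ]
    · have hupd : ∀ (w : ι → Fin 2) (c : Fin 2), (∀ j ∈ K, y ∉ S j (w j)) → y ∉ S i c →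
          ∀ j ∈ insert i K, y ∉ S j (Function.update w i c j) := by
        intro w c hw hc j hj
        rcases Finset.mem_insert.1 hj with rfl | hj
        · simpa using hc
        · rw [Function.update_of_ne (ne_of_mem_of_not_mem hj hi)]
          exact hw j hj
      by_cases hym : y ∈ S i m
      · obtain ⟨w, hw, hwy⟩ := hc₁ y ⟨hy, hym⟩
        exact ⟨_, Finset.mem_union_left _ (Finset.mem_image_of_mem _ hw),
          hupd w _ hwy (hSm y hym)⟩
      · obtain ⟨w, hw, hwy⟩ := hc₂ y ⟨hy, hym⟩
        exact ⟨_, Finset.mem_union_right _ (Finset.mem_image_of_mem _ hw), hupd w _ hwy hym⟩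

theorem card_powerset_filter_card_le (K : Finset ι) (d : ℕ) :
    (K.powerset.filter fun J => J.card ≤ d).card ≤ (K.card + 1) ^ d := by
  induction d with
  | zero =>
    rw [pow_zero, Finset.card_le_one]
    intro a ha b hb
    simp only [Nat.le_zero, Finset.card_eq_zero, Finset.mem_filter] at ha hb
    rw [ha.2, hb.2]
  | succ d ih =>
    calc _ ≤ ((K.powerset.filter fun J => J.card ≤ d) ∪ K.powersetCard (d + 1)).card := by
          refine Finset.card_le_card fun J hJ => ?_
          simp only [Finset.mem_filter, Finset.mem_powerset, Finset.mem_union,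
            Finset.mem_powersetCard] at hJ ⊢
          have := hJ.2
          rcases Nat.lt_or_ge d J.card with h | h
          · exact Or.inr ⟨hJ.1, by omega⟩
          · exact Or.inl ⟨hJ.1, h⟩
      _ ≤ (K.card + 1) ^ d + K.card ^ (d + 1) := by
          refine (Finset.card_union_le _ _).trans (add_le_add ih ?_)
          rw [Finset.card_powersetCard]
          exact Nat.choose_le_pow _ _
      _ ≤ (K.card + 1) ^ d + (K.card + 1) ^ d * K.card := by
          rw [pow_succ]
          gcongr
          omega
      _ = (K.card + 1) ^ (d + 1) := by ring

/-- If no set of more than `d` indices is shattered, quasi-polynomially many words suffice. -/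
theorem exists_words_of_card_le [Fintype ι] {S : ι → Fin 2 → Set Y}
    (hS : ∀ i, Disjoint (S i 0) (S i 1)) {d : ℕ}
    (hd : ∀ J : Finset ι, PartialShatters S univ J → J.card ≤ d) :
    ∃ W : Finset (ι → Fin 2),
      W.card ≤ (Fintype.card ι + 1) ^ ((d + 1) * (Nat.log 2 (Fintype.card ι + 1) + 1)) ∧
        ∀ y, ∃ w ∈ W, ∀ i, y ∉ S i (w i) := by
  set n := Fintype.card ι
  have hcount : shatterCount S Finset.univ univ < 2 ^ ((d + 1) * (Nat.log 2 (n + 1) + 1)) := by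
    calc shatterCount S Finset.univ univ
        ≤ ((Finset.univ : Finset ι).powerset.filter fun J => J.card ≤ d).card :=
          Finset.card_le_card (Finset.monotone_filter_right _ fun J _ hJ => hd J hJ)
      _ ≤ (n + 1) ^ d := card_powerset_filter_card_le _ _
      _ ≤ (n + 1) ^ (d + 1) := Nat.pow_le_pow_right (by omega) (by omega)
      _ < (2 ^ (Nat.log 2 (n + 1) + 1)) ^ (d + 1) :=
          Nat.pow_lt_pow_left (Nat.lt_pow_succ_log_self (by norm_num) _) (by omega)
      _ = 2 ^ ((d + 1) * (Nat.log 2 (n + 1) + 1)) := by rw [← pow_mul, mul_comm]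
  obtain ⟨W, hW, hc⟩ := exists_words_of_shatterCount_lt hS Finset.univ _ univ hcount
  refine ⟨W, hW, fun y => ?_⟩
  obtain ⟨w, hw, h⟩ := hc y (mem_univ y)
  exact ⟨w, hw, fun i => h i (Finset.mem_univ i)⟩

end PartialShattering

section SequenceEntropy

variable {G X : Type*}

theorem coverN_le_card_s5 {ι : Type*} {𝒱 : Set (Set X)} (T : Finset ι) (Y : ι → Set X)
    (hY : ∀ x, ∃ i ∈ T, x ∈ Y i) (h𝒱 : ∀ i, (Y i).Nonempty → ∃ V ∈ 𝒱, Y i ⊆ V) :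
    coverN 𝒱 ≤ T.card := by
  choose! V hV hYV using h𝒱
  set F := (T.filter fun i => (Y i).Nonempty).image V with hF
  have hcard : coverN 𝒱 ≤ F.card := by
    refine Nat.sInf_le ⟨F, fun U hU => ?_, rfl, eq_univ_of_forall fun x => ?_⟩
    · obtain ⟨i, hi, rfl⟩ := Finset.mem_image.1 (Finset.mem_coe.1 hU)
      exact hV i (Finset.mem_filter.1 hi).2
    · obtain ⟨i, hi, hx⟩ := hY x
      exact ⟨V i, Finset.mem_coe.2 (Finset.mem_image_of_mem V
        (Finset.mem_filter.2 ⟨hi, ⟨x, hx⟩⟩)), hYV i ⟨x, hx⟩ hx⟩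
  exact hcard.trans (Finset.card_image_le.trans (Finset.card_filter_le _ _))

theorem HasArbLargeIndep.mono {α : G → X → X} {k : ℕ} {A B : Fin k → Set X}
    (h : HasArbLargeIndep α A) (hAB : ∀ i, A i ⊆ B i) : HasArbLargeIndep α B := by
  intro n
  obtain ⟨F, hn, hF⟩ := h n
  refine ⟨F, hn, fun E hE hne ω => (hF E hE hne ω).mono ?_⟩
  exact iInter₂_mono fun g _ => preimage_mono (hAB _)

/-- An independence set for a disjoint pair of sets is the injective image of a shattered set. -/
theorem PartialShatters.exists_isIndepSet {α : G → X → X} {A : Fin 2 → Set X}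
    (hA : Disjoint (A 0) (A 1)) {ι : Type*} {g : ι → G} {J : Finset ι}
    (hJ : PartialShatters (fun i c => α (g i) ⁻¹' A c) univ J) :
    ∃ F : Finset G, F.card = J.card ∧ IsIndepSet α A ↑F := by
  refine ⟨J.image g, Finset.card_image_of_injOn fun i hi j hj hij => ?_, fun E hE _ ω => ?_⟩
  · by_contra hne
    obtain ⟨y, -, hy⟩ := hJ fun l => if l = i then 0 else 1
    have hyi := hy i hi
    have hyj := hy j hj
    simp only [if_true, if_neg (Ne.symm hne), ← hij, mem_preimage] at hyi hyj
    exact Set.disjoint_left.1 hA hyi hyj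
  · obtain ⟨y, -, hy⟩ := hJ fun i => ω (g i)
    refine ⟨y, mem_iInter₂.2 fun h hh => ?_⟩
    obtain ⟨i, hi, rfl⟩ := Finset.mem_image.1 (Finset.mem_coe.1 (hE hh))
    exact hy i hi

theorem two_pow_le_coverN {α : G → X → X} {A : Fin 2 → Set X} (hA : Disjoint (A 0) (A 1))
    {n : ℕ} (g : Fin n → G) {J : Finset (Fin n)} (hg : InjOn g J)
    (hJ : J.Nonempty) (hind : IsIndepSet α A (g '' J)) :
    2 ^ J.card ≤ coverN (joinPull α (range fun i => (A i)ᶜ) g) := by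
  have hcov : ∀ x, ∃ c : Fin 2, x ∈ (A c)ᶜ := fun x => by
    by_cases hx : x ∈ A 0
    · exact ⟨1, Set.disjoint_left.1 hA hx⟩
    · exact ⟨0, hx⟩
  have hne : {m : ℕ | ∃ F : Finset (Set X), ↑F ⊆ joinPull α (range fun i => (A i)ᶜ) g ∧
      F.card = m ∧ ⋃₀ (F : Set (Set X)) = Set.univ}.Nonempty := by
    refine ⟨_, Finset.univ.image fun w : Fin n → Fin 2 => ⋂ i, α (g i) ⁻¹' (A (w i))ᶜ, ?_, rfl,
      eq_univ_of_forall fun x => ?_⟩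
    · intro V hV
      obtain ⟨w, -, rfl⟩ := Finset.mem_image.1 (Finset.mem_coe.1 hV)
      exact ⟨fun i => (A (w i))ᶜ, fun i => ⟨w i, rfl⟩, rfl⟩
    · choose w hw using fun i => hcov (α (g i) x)
      exact ⟨_, Finset.mem_coe.2 (Finset.mem_image_of_mem _ (Finset.mem_univ w)),
        mem_iInter.2 hw⟩
  obtain ⟨F, hF, hcard, hU⟩ := Nat.sInf_mem hne
  have hpt : ∀ ω : J → Fin 2, ∃ y, ∀ j : J, α (g j) y ∈ A (ω j) := by
    intro ω
    have hinj : Function.Injective fun j : J => g j := fun j j' h => Subtype.ext (hg j.2 j'.2 h)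
    obtain ⟨y, hy⟩ := hind (J.image g) (by simp) (hJ.image g)
      (Function.extend (fun j : J => g j) ω fun _ => 0)
    refine ⟨y, fun j => ?_⟩
    have := mem_iInter₂.1 hy (g j) (Finset.mem_image_of_mem g j.2)
    rwa [hinj.extend_apply ω _ j] at this
  choose y hy using hpt
  have hmem : ∀ ω, ∃ V ∈ F, y ω ∈ V := fun ω => by
    simpa using (hU.symm ▸ mem_univ (y ω) : y ω ∈ ⋃₀ (F : Set (Set X)))
  choose V hVF hyV using hmem
  have hVinj : Function.Injective V := by
    intro ω ω' h
    obtain ⟨U, hU, hVU⟩ := hF (hVF ω)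
    choose c hc using hU
    have hne : ∀ ω₁, V ω₁ = V ω → ∀ j : J, ω₁ j ≠ c j := by
      intro ω₁ h₁ j hj
      have h₂ := hyV ω₁
      rw [h₁, hVU] at h₂
      have h₃ := mem_iInter.1 h₂ j
      rw [mem_preimage, ← hc] at h₃
      exact h₃ (hj ▸ hy ω₁ j)
    funext j
    have h₁ := hne ω rfl j
    have h₂ := hne ω' h.symm j
    omega
  calc 2 ^ J.card = (Finset.univ : Finset (J → Fin 2)).card := by simp
    _ ≤ F.card := Finset.card_le_card_of_injOn V (fun ω _ => hVF ω) hVinj.injOn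
    _ = _ := hcard

/-- Independence sets of size `2 ^ k` are arranged in dyadic blocks. -/
theorem HasArbLargeIndep.exists_seq [One G] {α : G → X → X} {k : ℕ} {A : Fin k → Set X}
    (h : HasArbLargeIndep α A) :
    ∃ 𝔰 : ℕ → G, ∀ m, InjOn 𝔰 (Ico (2 ^ m) (2 ^ (m + 1))) ∧
      IsIndepSet α A (𝔰 '' Ico (2 ^ m) (2 ^ (m + 1))) := by
  have hex : ∀ m : ℕ, ∃ e : ℕ → G, InjOn e (Ico (2 ^ m) (2 ^ (m + 1))) ∧
      IsIndepSet α A (e '' Ico (2 ^ m) (2 ^ (m + 1))) := by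
    intro m
    obtain ⟨F, hcard, hF⟩ := h (2 ^ m)
    obtain ⟨f⟩ : Nonempty (Finset.Ico (2 ^ m) (2 ^ (m + 1)) ↪ F) := by
      refine Function.Embedding.nonempty_of_card_le ?_
      rw [Fintype.card_coe, Fintype.card_coe, Nat.card_Ico, pow_succ]
      omega
    have he : ∀ i (hi : i ∈ Finset.Ico (2 ^ m) (2 ^ (m + 1))),
        Function.extend Subtype.val (fun i => (f i : G)) (fun _ => 1) i = f ⟨i, hi⟩ := fun i hi =>
      Subtype.val_injective.extend_apply (fun i => (f i : G)) _ ⟨i, hi⟩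
    refine ⟨Function.extend Subtype.val (fun i => (f i : G)) fun _ => 1, ?_, ?_⟩
    · intro i hi j hj hij
      rw [← Finset.coe_Ico, Finset.mem_coe] at hi hj
      rw [he i hi, he j hj] at hij
      exact congrArg Subtype.val (f.injective (Subtype.ext hij))
    · refine fun E hE => hF E (hE.trans ?_)
      rintro _ ⟨i, hi, rfl⟩
      rw [← Finset.coe_Ico, Finset.mem_coe] at hi
      rw [he i hi]
      exact (f ⟨i, hi⟩).2
  choose e heinj heind using hex
  refine ⟨fun i => e (Nat.log 2 i) i, fun m => ?_⟩
  have heq : EqOn (fun i => e (Nat.log 2 i) i) (e m) (Ico (2 ^ m) (2 ^ (m + 1))) := fun i hi => by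
    simp only [Nat.log_eq_of_pow_le_of_lt_pow hi.1 hi.2]
  exact ⟨(heinj m).congr heq.symm, by rw [heq.image_eq]; exact heind m⟩

theorem HasArbLargeIndep.exists_seqEntCover_pos [One G] {α : G → X → X} {A : Fin 2 → Set X}
    (hA : Disjoint (A 0) (A 1)) (h : HasArbLargeIndep α A) :
    ∃ 𝔰 : ℕ → G, 0 < seqEntCover α 𝔰 (range fun i => (A i)ᶜ) := by
  obtain ⟨𝔰, h𝔰⟩ := h.exists_seq
  refine ⟨𝔰, (ENNReal.ofReal_pos.2 (half_pos (Real.log_pos one_lt_two))).trans_le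
    (le_limsup_of_frequently_le (frequently_atTop.2 fun m => ⟨2 ^ (m + 1), ?_, ?_⟩))⟩
  · exact (Nat.lt_succ_self m).le.trans Nat.lt_two_pow_self.le
  · set J : Finset (Fin (2 ^ (m + 1))) := (Finset.Ico (2 ^ m) (2 ^ (m + 1))).attachFin
      fun i hi => (Finset.mem_Ico.1 hi).2 with hJ
    have hJmem : ∀ j ∈ J, (j : ℕ) ∈ Ico (2 ^ m) (2 ^ (m + 1)) := fun j hj => by
      simpa [hJ] using hj
    have hcard : J.card = 2 ^ m := by
      rw [hJ, Finset.card_attachFin, Nat.card_Ico, pow_succ]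
      omega
    have hlow := two_pow_le_coverN hA (fun i : Fin (2 ^ (m + 1)) => 𝔰 i) (J := J)
      (fun i hi j hj hij => Fin.ext ((h𝔰 m).1 (hJmem i hi) (hJmem j hj) hij))
      (Finset.card_pos.1 (by rw [hcard]; positivity))
      (fun E hE => (h𝔰 m).2 E (hE.trans (by
        rintro _ ⟨i, hi, rfl⟩
        exact ⟨i, hJmem i hi, rfl⟩)))
    rw [hcard] at hlow
    refine ENNReal.ofReal_le_ofReal ?_
    have hlog := Real.log_le_log (by positivity) (Nat.cast_le (α := ℝ).2 hlow)
    push_cast at hlog ⊢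
    rw [Real.log_pow] at hlog
    push_cast at hlog
    rw [le_div_iff₀ (by positivity)]
    calc Real.log 2 / 2 * 2 ^ (m + 1) = 2 ^ m * Real.log 2 := by ring
      _ ≤ _ := hlog

theorem tendsto_quasipolynomial_exponent (D : ℕ) :
    Tendsto (fun n : ℕ => ((D * (Nat.log 2 (n + 1) + 1) : ℕ) : ℝ) * Real.log (n + 1) / n)
      atTop (𝓝 0) := by
  have hlim : Tendsto (fun x : ℝ => 2 * D * ((Real.log x ^ 2 / x) / Real.log 2 +
      Real.log x ^ 1 / x)) atTop (𝓝 0) := by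
    have h₂ := (Real.isLittleO_pow_log_id_atTop (n := 2)).tendsto_div_nhds_zero
    have h₁ := (Real.isLittleO_pow_log_id_atTop (n := 1)).tendsto_div_nhds_zero
    simpa using ((h₂.div_const (Real.log 2)).add h₁).const_mul (2 * D : ℝ)
  have hlim' := hlim.comp ((tendsto_natCast_atTop_atTop (R := ℝ)).comp (tendsto_add_atTop_nat 1))
  refine squeeze_zero' (Eventually.of_forall fun n => ?_) ?_ hlim'
  · exact div_nonneg (mul_nonneg (Nat.cast_nonneg _) (Real.log_nonneg (by simp))) n.cast_nonneg
  · filter_upwards [eventually_ge_atTop 1] with n hn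
    have hn' : (1 : ℝ) ≤ n := by exact_mod_cast hn
    have hlog : (0 : ℝ) ≤ Real.log (n + 1) := Real.log_nonneg (by linarith)
    have hnat : (Nat.log 2 (n + 1) : ℝ) ≤ Real.log (n + 1) / Real.log 2 := by
      have := Real.natLog_le_logb (n + 1) 2
      simpa [Real.logb] using this
    have hlog2 : 0 < Real.log 2 := Real.log_pos one_lt_two
    simp only [Function.comp_apply]
    push_cast
    calc (D : ℝ) * (Nat.log 2 (n + 1) + 1) * Real.log (n + 1) / n
        ≤ D * (Real.log (n + 1) / Real.log 2 + 1) * Real.log (n + 1) / ((n + 1) / 2) := by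
          gcongr
          linarith
      _ = _ := by
          field_simp

theorem seqEntCover_eq_zero_of_coverN_le {α : G → X → X} {𝔰 : ℕ → G} {𝒰 : Set (Set X)} {D : ℕ}
    (h : ∀ n, coverN (joinPull α 𝒰 fun i : Fin n => 𝔰 i) ≤
      (n + 1) ^ (D * (Nat.log 2 (n + 1) + 1))) :
    seqEntCover α 𝔰 𝒰 = 0 := by
  have hbound : ∀ n : ℕ, Real.log (coverN (joinPull α 𝒰 fun i : Fin n => 𝔰 i)) / n ≤
      ((D * (Nat.log 2 (n + 1) + 1) : ℕ) : ℝ) * Real.log (n + 1) / n := by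
    intro n
    gcongr
    rcases (coverN (joinPull α 𝒰 fun i : Fin n => 𝔰 i)).eq_zero_or_pos with h₀ | h₀
    · rw [h₀, Nat.cast_zero, Real.log_zero]
      exact mul_nonneg (Nat.cast_nonneg _) (Real.log_nonneg (by simp))
    · rw [← Real.log_pow]
      exact Real.log_le_log (by exact_mod_cast h₀) (by exact_mod_cast h n)
  have hlim := squeeze_zero
    (fun n : ℕ => div_nonneg (Real.log_natCast_nonneg _) n.cast_nonneg) hbound
    (tendsto_quasipolynomial_exponent D)
  exact (ENNReal.tendsto_ofReal hlim).limsup_eq.trans ENNReal.ofReal_zero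

/-- If points at distance at least `δ` are separated by finitely many disjoint pairs whose
independence sets have bounded size, then covers with Lebesgue number `δ` have
quasi-polynomial growth along every tuple. -/
theorem coverN_joinPull_le [PseudoMetricSpace X] {κ : Type*} {α : G → X → X} {𝒰 : Set (Set X)}
    {δ : ℝ} (hδ : ∀ x : X, ∃ U ∈ 𝒰, Metric.ball x δ ⊆ U) (t : Finset κ)
    (A : κ → Fin 2 → Set X) (d : κ → ℕ) (hA : ∀ p ∈ t, Disjoint (A p 0) (A p 1))
    (hd : ∀ p ∈ t, ∀ F : Finset G, IsIndepSet α (A p) F → F.card ≤ d p)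
    (hsep : ∀ x y : X, δ ≤ dist x y → ∃ p ∈ t, x ∈ A p 0 ∧ y ∈ A p 1) {n : ℕ} (g : Fin n → G) :
    coverN (joinPull α 𝒰 g) ≤
      (n + 1) ^ ((∑ p ∈ t, (d p + 1)) * (Nat.log 2 (n + 1) + 1)) := by
  have hex : ∀ p : t, ∃ W : Finset (Fin n → Fin 2),
      W.card ≤ (n + 1) ^ ((d p + 1) * (Nat.log 2 (n + 1) + 1)) ∧
        ∀ y, ∃ w ∈ W, ∀ i, y ∉ α (g i) ⁻¹' A p (w i) := by
    intro p
    have := exists_words_of_card_le (S := fun i c => α (g i) ⁻¹' A p c) (d := d p)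
      (fun i => (hA p p.2).preimage _) fun J hJ => by
        obtain ⟨F, hFJ, hF⟩ := hJ.exists_isIndepSet (hA p p.2)
        exact hFJ ▸ hd p p.2 F hF
    simpa using this
  choose W hW hc using hex
  calc coverN (joinPull α 𝒰 g) ≤ (Fintype.piFinset W).card := by
        refine coverN_le_card_s5 _ (fun w => {y | ∀ (p : t) i, α (g i) y ∉ A p (w p i)}) (fun x => ?_) ?_
        · choose w hw hwx using fun p => hc p x
          exact ⟨w, Fintype.mem_piFinset.2 hw, hwx⟩
        · rintro w ⟨y, hy⟩
          choose U hU hball using fun i => hδ (α (g i) y)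
          refine ⟨_, ⟨U, hU, rfl⟩, fun x hx => mem_iInter.2 fun i => hball i ?_⟩
          rw [Metric.mem_ball]
          by_contra! hdist
          obtain ⟨p, hp, hx₀, hy₁⟩ := hsep _ _ hdist
          have h₀ := hx ⟨p, hp⟩ i
          have h₁ := hy ⟨p, hp⟩ i
          generalize w ⟨p, hp⟩ i = c at h₀ h₁
          fin_cases c
          · exact h₀ hx₀
          · exact h₁ hy₁
    _ = ∏ p, (W p).card := Fintype.card_piFinset W
    _ ≤ ∏ p : t, (n + 1) ^ ((d p + 1) * (Nat.log 2 (n + 1) + 1)) :=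
        Finset.prod_le_prod' fun p _ => hW p
    _ = _ := by
        rw [Finset.prod_coe_sort t fun p => (n + 1) ^ ((d p + 1) * (Nat.log 2 (n + 1) + 1)),
          Finset.prod_pow_eq_pow_sum, Finset.sum_mul]

theorem exists_isINTuple_of_seqEnt_pos [MetricSpace X] [CompactSpace X] {α : G → X → X}
    {𝔰 : ℕ → G} (h : 0 < seqEnt α 𝔰) : ∃ x : Fin 2 → X, IsINTuple α x ∧ x 0 ≠ x 1 := by
  by_contra! hno
  refine h.ne' (iSup₂_eq_bot.2 fun 𝒰 h𝒰 => ?_)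
  obtain ⟨δ, hδ, hball⟩ := lebesgue_number_lemma_of_metric_sUnion isCompact_univ h𝒰.1 h𝒰.2.ge
  have hloc : ∀ p : X × X, p.1 ≠ p.2 → ∃ (A : Fin 2 → Set X) (d : ℕ),
      (∀ i, IsOpen (A i)) ∧ p.1 ∈ A 0 ∧ p.2 ∈ A 1 ∧ Disjoint (A 0) (A 1) ∧
        ∀ F : Finset G, IsIndepSet α A F → F.card ≤ d := by
    intro p hp
    have hnot : ¬ IsINTuple α ![p.1, p.2] := fun hIN => hp (by simpa using hno _ hIN)
    simp only [IsINTuple, not_forall] at hnot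
    obtain ⟨U, hUo, hpU, hU⟩ := hnot
    obtain ⟨V, V', hV, hV', hpV, hpV', hdisj⟩ := t2_separation hp
    have hnind : ¬ HasArbLargeIndep α fun i => U i ∩ (![V, V'] : Fin 2 → Set X) i :=
      fun hind => hU (hind.mono fun i => inter_subset_left)
    simp only [HasArbLargeIndep, not_forall, not_exists, not_and] at hnind
    obtain ⟨d, hd⟩ := hnind
    refine ⟨fun i => U i ∩ (![V, V'] : Fin 2 → Set X) i, d, fun i => ?_,
      ⟨by simpa using hpU 0, hpV⟩, ⟨by simpa using hpU 1, hpV'⟩,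
      hdisj.mono inter_subset_right inter_subset_right, fun F hF => ?_⟩
    · fin_cases i
      · exact (hUo 0).inter hV
      · exact (hUo 1).inter hV'
    · by_contra! hlt
      exact hd F hlt.le hF
  choose! A d hAo hA₀ hA₁ hdisj hd using hloc
  have hne : ∀ p ∈ {p : X × X | δ ≤ dist p.1 p.2}, p.1 ≠ p.2 := fun p hp =>
    dist_pos.1 (hδ.trans_le hp)
  obtain ⟨t, ht, hcov⟩ := (isClosed_le continuous_const
    (continuous_fst.dist continuous_snd)).isCompact.elim_nhds_subcover
      (fun p : X × X => A p 0 ×ˢ A p 1) fun p hp =>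
        ((hAo p (hne p hp) 0).prod (hAo p (hne p hp) 1)).mem_nhds
          ⟨hA₀ p (hne p hp), hA₁ p (hne p hp)⟩
  refine seqEntCover_eq_zero_of_coverN_le fun n =>
    coverN_joinPull_le (fun x => hball x (mem_univ x)) t A d (fun p hp => hdisj p (hne p (ht p hp)))
      (fun p hp => hd p (hne p (ht p hp))) (fun x y hxy => ?_) _
  obtain ⟨p, hp, hxyp⟩ := mem_iUnion₂.1
    (hcov (show (x, y) ∈ {p : X × X | δ ≤ dist p.1 p.2} from hxy))
  exact ⟨p, hp, hxyp⟩

theorem IsINTuple.exists_seqEnt_pos [One G] [TopologicalSpace X] [T25Space X]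
    {α : G → X → X} {x : Fin 2 → X} (hx : IsINTuple α x) (hne : x 0 ≠ x 1) :
    ∃ 𝔰 : ℕ → G, 0 < seqEnt α 𝔰 := by
  obtain ⟨U, hU, V, hV, hdisj⟩ := exists_nhds_disjoint_closure hne
  have hA : HasArbLargeIndep α ![closure U, closure V] := by
    refine (hx ![interior U, interior V] (fun i => ?_) fun i => ?_).mono fun i => ?_
    · fin_cases i <;> exact isOpen_interior
    · fin_cases i
      · exact mem_interior_iff_mem_nhds.2 hU
      · exact mem_interior_iff_mem_nhds.2 hV
    · fin_cases i <;> exact interior_subset.trans subset_closure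
  obtain ⟨𝔰, h𝔰⟩ := hA.exists_seqEntCover_pos hdisj
  refine ⟨𝔰, h𝔰.trans_le (le_iSup₂_of_le _ ⟨?_, ?_⟩ le_rfl)⟩
  · rintro _ ⟨i, rfl⟩
    fin_cases i <;> exact isClosed_closure.isOpen_compl
  · refine eq_univ_of_forall fun y => ?_
    by_cases hy : y ∈ closure U
    · exact ⟨(closure V)ᶜ, ⟨1, rfl⟩, Set.disjoint_left.1 hdisj hy⟩
    · exact ⟨(closure U)ᶜ, ⟨0, rfl⟩, hy⟩

end SequenceEntropy

/-- Kerr–Li: `IN₂(X,G) \ Δ₂(X) ≠ ∅` iff the system is nonnull. -/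
theorem nondiagonal_IN_pair_iff_nonnull
    {G X : Type*} [Group G] [Countable G] [Infinite G] [MetricSpace X] [CompactSpace X]
    (α : G → X → X) (hα : IsActionBy α) :
    (∃ x : Fin 2 → X, IsINTuple α x ∧ x 0 ≠ x 1) ↔ (∃ 𝔰 : ℕ → G, 0 < seqEnt α 𝔰) := by
  constructor
  · rintro ⟨x, hx, hne⟩
    exact hx.exists_seqEnt_pos hne
  · rintro ⟨𝔰, h𝔰⟩
    exact exists_isINTuple_of_seqEnt_pos h𝔰
end
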